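/- Let G be a finite undirected graph in which every vertex has positive degree, with double cover H. Let α ∈ (0,1], let s be a nonnegative vector with ‖s‖₁ = 1 and r a nonnegative vector such that apr_H(α, s, r) is entrywise nonnegative, and set p = σ∘apr_H(α, s, r); suppose max_{u ∈ V_H} r(u)/deg(u) ≤ ε. Let φ ∈ [0,1]. If Φ_H(S_j^p) ≥ φ for all j ∈ [1, |supp(p)|], then for all k ∈ [0, vol(V_H)] and all integers t ≥ 0, p[k] − k/vol(V_H) ≤ αt + αεkt + √(min(k, vol(V_H) − k))·(1 − φ²/8)^t. -/

import Mathlib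

open Finset

namespace Paper

variable {V : Type*} [Fintype V] [DecidableEq V]

/-- The degree of a vertex `v` in the graph `G`. -/
noncomputable def deg (G : SimpleGraph V) (v : V) : ℕ := {u | G.Adj v u}.ncard

/-- The volume of a set of vertices: the sum of the degrees of its members. -/
noncomputable def vol (G : SimpleGraph V) (S : Finset V) : ℕ := ∑ v ∈ S, deg G v

/-- The number of ordered pairs `(u,v)` with `u ∈ S`, `v ∈ T` and `{u,v} ∈ E(G)`.
For disjoint `S`, `T` this is the number of edges between `S` and `T`, and
`cutEdges G S Sᶜ = |∂(S)|`. -/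
noncomputable def cutEdges (G : SimpleGraph V) (S T : Finset V) : ℕ :=
  {e : V × V | e.1 ∈ S ∧ e.2 ∈ T ∧ G.Adj e.1 e.2}.ncard

/-- The conductance `Φ(S) = |∂(S)| / min(vol(S), vol(V \ S))`. -/
noncomputable def conductance (G : SimpleGraph V) (S : Finset V) : ℝ :=
  (cutEdges G S Sᶜ : ℝ) / min (vol G S : ℝ) (vol G Sᶜ : ℝ)

/-- The bipartiteness ratio `β(L,R) = 1 - 2 e(L,R) / vol(L ∪ R)`. -/
noncomputable def bipartiteness (G : SimpleGraph V) (L R : Finset V) : ℝ :=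
  1 - 2 * (cutEdges G L R : ℝ) / (vol G (L ∪ R) : ℝ)

/-- The double cover of `G`: on vertex set `V ⊕ V` (with `Sum.inl v = v₁` and
`Sum.inr v = v₂`), for every edge `{u,v}` of `G` there are edges `{u₁,v₂}` and `{u₂,v₁}`. -/
def doubleCover (G : SimpleGraph V) : SimpleGraph (V ⊕ V) :=
  SimpleGraph.fromRel (fun x y => ∃ u v, x = Sum.inl u ∧ y = Sum.inr v ∧ G.Adj u v)

open scoped Classical in
/-- One step of the lazy random walk `W = (1/2)(I + D⁻¹A)`, acting on row vectors:
`p ↦ pW`, so `(lazyWalk G p) x = (1/2) p(x) + (1/2) ∑_{y ~ x} p(y)/deg(y)`. -/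
noncomputable def lazyWalk (G : SimpleGraph V) (p : V → ℝ) : V → ℝ :=
  fun x => (1/2) * p x + (1/2) * ∑ y, (if G.Adj y x then p y / (deg G y : ℝ) else 0)

/-- The simplify operator `σ` on vectors indexed by the double cover:
`(σ∘p)(u₁) = max(0, p(u₁) - p(u₂))` and `(σ∘p)(u₂) = max(0, p(u₂) - p(u₁))`. -/
noncomputable def simplify (p : V ⊕ V → ℝ) : V ⊕ V → ℝ :=
  Sum.elim (fun u => max 0 (p (Sum.inl u) - p (Sum.inr u)))
           (fun u => max 0 (p (Sum.inr u) - p (Sum.inl u)))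

/-- `q` is the personalised Pagerank vector `pr(α, s)`, i.e. it satisfies
`q = α s + (1-α) q W`. -/
def IsPagerank (G : SimpleGraph V) (α : ℝ) (s q : V → ℝ) : Prop :=
  ∀ x, q x = α * s x + (1 - α) * lazyWalk G q x

/-- `p` is an approximate Pagerank vector `apr(α, s, r)` with residual `r`, i.e.
`p + pr(α, r) = pr(α, s)`. -/
def IsApr (G : SimpleGraph V) (α : ℝ) (s r p : V → ℝ) : Prop :=
  ∃ qs qr, IsPagerank G α s qs ∧ IsPagerank G α r qr ∧ ∀ x, p x + qr x = qs x

/-- Given an ordering `ord` of the vertices, the sweep set `S_j` consists of the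
first `j` vertices in this ordering. -/
def sweepSet {W : Type*} [Fintype W] (ord : Fin (Fintype.card W) ≃ W) (j : ℕ) :
    Finset W :=
  Finset.univ.filter fun x => (ord.symm x : ℕ) < j

/-- The size of the support `supp(p) = {u : p(u) ≠ 0}` of a vector. -/
noncomputable def suppCard {W : Type*} (p : W → ℝ) : ℕ := {x | p x ≠ 0}.ncard

/-- The Lovász–Simonovits curve of a vector `p`:
`p[x] = max { ∑_u w(u) p(u) : w ∈ [0,1]^V, ∑_u w(u) deg(u) = x }`. -/
noncomputable def lsCurve (G : SimpleGraph V) (p : V → ℝ) (x : ℝ) : ℝ :=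
  sSup {y | ∃ w : V → ℝ, (∀ u, 0 ≤ w u ∧ w u ≤ 1) ∧
    (∑ u, w u * (deg G u : ℝ)) = x ∧ y = ∑ u, w u * p u}

/-! ### Directed graphs -/

/-- Out-degree of `u` in the digraph with edge relation `E`. -/
noncomputable def degOut (E : V → V → Prop) (u : V) : ℕ := {v | E u v}.ncard

/-- In-degree of `u` in the digraph with edge relation `E`. -/
noncomputable def degIn (E : V → V → Prop) (u : V) : ℕ := {v | E v u}.ncard

/-- Out-volume `vol_out(S) = ∑_{u ∈ S} deg_out(u)`. -/
noncomputable def volOut (E : V → V → Prop) (S : Finset V) : ℕ := ∑ u ∈ S, degOut E u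

/-- In-volume `vol_in(S) = ∑_{u ∈ S} deg_in(u)`. -/
noncomputable def volIn (E : V → V → Prop) (S : Finset V) : ℕ := ∑ u ∈ S, degIn E u

/-- The number of directed edges from `L` to `R`. -/
noncomputable def eDir (E : V → V → Prop) (L R : Finset V) : ℕ :=
  {e : V × V | e.1 ∈ L ∧ e.2 ∈ R ∧ E e.1 e.2}.ncard

/-- The total number of directed edges of the digraph. -/
noncomputable def numEdges (E : V → V → Prop) : ℕ := {e : V × V | E e.1 e.2}.ncard

/-- The flow ratio `F(L,R) = 1 - 2 e(L,R) / (vol_out(L) + vol_in(R))`. -/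
noncomputable def flowRatio (E : V → V → Prop) (L R : Finset V) : ℝ :=
  1 - 2 * (eDir E L R : ℝ) / ((volOut E L : ℝ) + (volIn E R : ℝ))

/-- The semi-double cover of a digraph: on vertex set `V ⊕ V` (with `Sum.inl v = v₁`,
`Sum.inr v = v₂`), for every directed edge `(u,v)` there is an undirected edge `{u₁, v₂}`. -/
def semiDoubleCover (E : V → V → Prop) : SimpleGraph (V ⊕ V) :=
  SimpleGraph.fromRel (fun x y => ∃ u v, x = Sum.inl u ∧ y = Sum.inr v ∧ E u v)

/-! ### The evolving set process -/

/-- `χ_v W χ_S^T`: the probability that one step of the lazy random walk started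
at `v` ends in `S`. -/
noncomputable def walkToSet (H : SimpleGraph V) (S : Finset V) (v : V) : ℝ :=
  (1/2) * (if v ∈ S then (1:ℝ) else 0)
    + (1/2) * (({y | H.Adj v y ∧ y ∈ S}.ncard : ℝ) / (deg H v : ℝ))

/-- The transition kernel `K(S, S')` of the evolving set process: the probability,
over a uniformly random threshold `t ∈ [0,1]`, that `{v : χ_v W χ_S^T ≥ t} = S'`. -/
noncomputable def espKernel (H : SimpleGraph V) (S S' : Finset V) : ℝ :=
  (MeasureTheory.volume {t : ℝ | t ∈ Set.Icc (0:ℝ) 1 ∧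
    {v | t ≤ walkToSet H S v} = (S' : Set V)}).toReal

/-- The transition kernel `K̂(S,S') = (vol(S')/vol(S)) K(S,S')` of the volume-biased
evolving set process. -/
noncomputable def vbKernel (H : SimpleGraph V) (S S' : Finset V) : ℝ :=
  ((vol H S' : ℝ) / (vol H S : ℝ)) * espKernel H S S'

open scoped Classical in
/-- The probability that a sample path `(S₀, …, S_T)` of the volume-biased evolving
set process started from `S₀ = {x}` satisfies the property `P`. -/
noncomputable def pathProb (H : SimpleGraph V) (T : ℕ) (x : V)
    (P : (Fin (T+1) → Finset V) → Prop) : ℝ :=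
  ∑ f ∈ Finset.univ.filter (fun f : Fin (T+1) → Finset V => f 0 = {x} ∧ P f),
    ∏ i : Fin T, vbKernel H (f i.castSucc) (f i.succ)

set_option linter.unusedSectionVars false

section LovaszSimonovits

variable {W : Type*} [Fintype W] [DecidableEq W]

open scoped Classical in
/-- The real-valued adjacency indicator of a graph. -/
noncomputable def adjInd (H : SimpleGraph W) (u v : W) : ℝ := if H.Adj u v then 1 else 0

lemma adjInd_nonneg (H : SimpleGraph W) (u v : W) : 0 ≤ adjInd H u v := by
  unfold adjInd; split_ifs <;> norm_num

lemma adjInd_comm (H : SimpleGraph W) (u v : W) : adjInd H u v = adjInd H v u := by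
  classical
  unfold adjInd
  exact if_congr (H.adj_comm u v) rfl rfl

lemma deg_eq_sum_adjInd (H : SimpleGraph W) (u : W) :
    (deg H u : ℝ) = ∑ v, adjInd H u v := by
  classical
  unfold deg adjInd
  rw [Set.ncard_eq_toFinset_card', Finset.sum_boole]
  congr 2
  ext v
  simp

lemma cutEdges_eq_sum_adjInd (H : SimpleGraph W) (S T : Finset W) :
    (cutEdges H S T : ℝ) = ∑ u ∈ S, ∑ v ∈ T, adjInd H u v := by
  classical
  unfold cutEdges adjInd
  rw [← Finset.sum_product', Finset.sum_boole, Set.ncard_eq_toFinset_card']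
  congr 2
  ext e
  simp [and_assoc]

lemma lazyWalk_eq (H : SimpleGraph W) (p : W → ℝ) (x : W) :
    lazyWalk H p x = (1/2) * p x + (1/2) * ∑ y, adjInd H y x * (p y / (deg H y : ℝ)) := by
  simp only [lazyWalk, adjInd, ite_mul, one_mul, zero_mul]

/-- The mass of `S` after one lazy step is the average of the masses of two fractional sets. -/
lemma sum_lazyWalk (H : SimpleGraph W) (p : W → ℝ) (S : Finset W) :
    ∑ x ∈ S, lazyWalk H p x
      = (1/2) * (∑ x ∈ S, p x + ∑ y, (∑ x ∈ S, adjInd H y x) / (deg H y : ℝ) * p y) := by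
  simp only [lazyWalk_eq, Finset.sum_add_distrib, ← Finset.mul_sum]
  rw [Finset.sum_comm, mul_add]
  congr 2
  refine Finset.sum_congr rfl fun y _ => ?_
  rw [← Finset.sum_mul]
  ring

lemma sum_lazyWalk_univ (H : SimpleGraph W) (hdeg : ∀ v, 0 < deg H v) (p : W → ℝ) :
    ∑ x, lazyWalk H p x = ∑ x, p x := by
  rw [sum_lazyWalk]
  have : ∀ y, (∑ x, adjInd H y x) / (deg H y : ℝ) * p y = p y := fun y => by
    have : (deg H y : ℝ) ≠ 0 := by exact_mod_cast (hdeg y).ne'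
    rw [← deg_eq_sum_adjInd, div_self this, one_mul]
  simp only [this]
  ring

lemma IsPagerank.sum_eq {H : SimpleGraph W} (hdeg : ∀ v, 0 < deg H v) {α : ℝ} (hα : 0 < α)
    {s q : W → ℝ} (h : IsPagerank H α s q) : ∑ x, q x = ∑ x, s x := by
  have h1 : ∑ x, q x = α * ∑ x, s x + (1 - α) * ∑ x, q x := by
    calc ∑ x, q x = ∑ x, (α * s x + (1 - α) * lazyWalk H q x) :=
          Finset.sum_congr rfl fun x _ => h x
      _ = _ := by
          rw [Finset.sum_add_distrib, ← Finset.mul_sum, ← Finset.mul_sum,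
            sum_lazyWalk_univ H hdeg]
  have h2 : α * (∑ x, q x - ∑ x, s x) = 0 := by linarith
  rcases mul_eq_zero.1 h2 with h3 | h3
  · exact absurd h3 hα.ne'
  · linarith

lemma sqrt_add_sqrt_le {x d φ : ℝ} (hφ0 : 0 ≤ φ) (hφ1 : φ ≤ 1) (hx : 0 ≤ x)
    (hd : φ * x ≤ d) (hdx : d ≤ x) :
    √(x + d) + √(x - d) ≤ 2 * (√x * (1 - φ ^ 2 / 8)) := by
  have hφx : 0 ≤ φ * x := mul_nonneg hφ0 hx
  have hφ2 : φ ^ 2 ≤ 1 := by nlinarith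
  have ha := Real.sq_sqrt (show 0 ≤ x + d by linarith)
  have hb := Real.sq_sqrt (show 0 ≤ x - d by linarith)
  have hc := Real.sq_sqrt hx
  have hab : √(x + d) * √(x - d) ≤ x * (1 - φ ^ 2 / 2) := by
    rw [← Real.sqrt_mul (by linarith)]
    apply Real.sqrt_le_iff.2
    constructor
    · exact mul_nonneg hx (by linarith)
    · have : (φ * x) ^ 2 ≤ d ^ 2 := pow_le_pow_left₀ hφx hd 2
      nlinarith [sq_nonneg (x * φ ^ 2)]
  refine (sq_le_sq₀ (by positivity) (mul_nonneg zero_le_two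
    (mul_nonneg (Real.sqrt_nonneg x) (by linarith)))).1 ?_
  have h4 : 0 ≤ x * (φ ^ 2) ^ 2 := by positivity
  nlinarith

lemma sweepSet_zero (ord : Fin (Fintype.card W) ≃ W) : sweepSet ord 0 = ∅ := by
  simp [sweepSet]

lemma sweepSet_card (ord : Fin (Fintype.card W) ≃ W) :
    sweepSet ord (Fintype.card W) = Finset.univ := by
  simp [sweepSet]

lemma sweepSet_succ (ord : Fin (Fintype.card W) ≃ W) {j : ℕ} (hj : j < Fintype.card W) :
    sweepSet ord (j + 1) = insert (ord ⟨j, hj⟩) (sweepSet ord j) := by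
  ext x
  simp only [sweepSet, Finset.mem_filter, Finset.mem_univ, true_and, Finset.mem_insert,
    Nat.lt_succ_iff_lt_or_eq, ← Equiv.symm_apply_eq, Fin.ext_iff]
  tauto

lemma notMem_sweepSet (ord : Fin (Fintype.card W) ≃ W) {j : ℕ} (hj : j < Fintype.card W) :
    ord ⟨j, hj⟩ ∉ sweepSet ord j := by
  simp [sweepSet]

/-- If a concave function dominates the Lovász–Simonovits curve at the volumes of all sweep
sets, then it dominates it everywhere. -/
lemma sum_mul_le_of_sweepSet (H : SimpleGraph W) (hdeg : ∀ v, 0 < deg H v) (p : W → ℝ)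
    (ord : Fin (Fintype.card W) ≃ W)
    (hord : ∀ i j, i ≤ j → p (ord j) / (deg H (ord j) : ℝ) ≤ p (ord i) / (deg H (ord i) : ℝ))
    {g : ℝ → ℝ} (hg : ConcaveOn ℝ (Set.Icc 0 (vol H univ : ℝ)) g)
    (hsweep : ∀ j ≤ Fintype.card W, ∑ x ∈ sweepSet ord j, p x ≤ g (vol H (sweepSet ord j)))
    {w : W → ℝ} (hw : ∀ u, 0 ≤ w u ∧ w u ≤ 1) :
    ∑ u, w u * p u ≤ g (∑ u, w u * (deg H u : ℝ)) := by
  have hD : ∀ v, (0 : ℝ) < deg H v := fun v => by exact_mod_cast hdeg v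
  have key : ∀ j ≤ Fintype.card W, ∑ u, w u * (deg H u : ℝ) ≤ vol H (sweepSet ord j) →
      ∑ u, w u * p u ≤ g (∑ u, w u * (deg H u : ℝ)) := by
    intro j
    induction j with
    | zero =>
      intro h0 hk
      have hnn : ∀ u ∈ Finset.univ, 0 ≤ w u * (deg H u : ℝ) :=
        fun u _ => mul_nonneg (hw u).1 (hD u).le
      have hk0 : ∑ u, w u * (deg H u : ℝ) = 0 := by
        refine le_antisymm ?_ (Finset.sum_nonneg hnn)
        simpa [sweepSet_zero, vol] using hk
      have hw0 : ∀ u, w u = 0 := fun u => by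
        have := (Finset.sum_eq_zero_iff_of_nonneg hnn).1 hk0 u (Finset.mem_univ u)
        exact (mul_eq_zero.1 this).resolve_right (hD u).ne'
      have h := hsweep 0 h0
      rw [hk0]
      simpa [sweepSet_zero, vol, hw0] using h
    | succ j ih =>
      intro hj hk
      by_cases hkj : ∑ u, w u * (deg H u : ℝ) ≤ vol H (sweepSet ord j)
      · exact ih (by omega) hkj
      have hjn : j < Fintype.card W := hj
      set v := ord ⟨j, hjn⟩ with hv
      set k := ∑ u, w u * (deg H u : ℝ) with hkdef
      have hvol : (vol H (sweepSet ord (j + 1)) : ℝ) = vol H (sweepSet ord j) + deg H v := by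
        rw [sweepSet_succ ord hjn, vol, Finset.sum_insert (notMem_sweepSet ord hjn), vol]
        push_cast
        ring
      have hmass : ∑ x ∈ sweepSet ord (j + 1), p x = ∑ x ∈ sweepSet ord j, p x + p v := by
        rw [sweepSet_succ ord hjn, Finset.sum_insert (notMem_sweepSet ord hjn), add_comm]
      have hupper : ∑ u, w u * p u
          ≤ ∑ x ∈ sweepSet ord j, p x + p v / deg H v * (k - vol H (sweepSet ord j)) := by
        have h1 : ∑ x ∈ sweepSet ord j, p x + p v / deg H v * (k - vol H (sweepSet ord j))
            - ∑ u, w u * p u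
            = ∑ u, ((if u ∈ sweepSet ord j then 1 else 0) - w u)
                * (p u - p v / deg H v * deg H u) := by
          have h2 : ∀ u, ((if u ∈ sweepSet ord j then 1 else 0) - w u)
                * (p u - p v / deg H v * deg H u)
              = (if u ∈ sweepSet ord j then p u - p v / deg H v * deg H u else 0)
                - (w u * p u) + p v / deg H v * (w u * deg H u) := fun u => by
            split_ifs <;> ring
          simp only [h2, Finset.sum_add_distrib, Finset.sum_sub_distrib, ← Finset.mul_sum,
            Finset.sum_ite_mem, Finset.univ_inter, vol, Nat.cast_sum, hkdef]
          ring
        have h3 : 0 ≤ ∑ u, ((if u ∈ sweepSet ord j then 1 else 0) - w u)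
                * (p u - p v / deg H v * deg H u) := by
          refine Finset.sum_nonneg fun u _ => ?_
          obtain ⟨i, rfl⟩ := ord.surjective u
          have hi : ord i ∈ sweepSet ord j ↔ (i : ℕ) < j := by simp [sweepSet]
          split_ifs with hmem
          · have := hord i ⟨j, hjn⟩ (Fin.le_def.2 (hi.1 hmem).le)
            rw [← hv, le_div_iff₀ (hD _)] at this
            exact mul_nonneg (by linarith [(hw (ord i)).2]) (by linarith)
          · have := hord ⟨j, hjn⟩ i (Fin.le_def.2 (not_lt.1 (fun h => hmem (hi.2 h))))
            rw [← hv, div_le_iff₀ (hD _)] at this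
            exact mul_nonneg_of_nonpos_of_nonpos (by linarith [(hw (ord i)).1]) (by linarith)
        linarith
      push Not at hkj
      have hvpos := hD v
      set θ := (k - vol H (sweepSet ord j)) / deg H v with hθ
      have hθ0 : 0 ≤ θ := div_nonneg (by linarith) hvpos.le
      have hθ1 : θ ≤ 1 := by rw [hθ, div_le_one hvpos]; linarith
      have hmem : ∀ i, (vol H (sweepSet ord i) : ℝ) ∈ Set.Icc 0 (vol H univ : ℝ) := fun i =>
        ⟨Nat.cast_nonneg _, by
          exact_mod_cast Finset.sum_le_sum_of_subset (Finset.subset_univ (sweepSet ord i))⟩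
      have hcc := hg.2 (hmem j) (hmem (j + 1)) (sub_nonneg.2 hθ1) hθ0 (by ring)
      simp only [smul_eq_mul] at hcc
      have hkeq : (1 - θ) * (vol H (sweepSet ord j) : ℝ) + θ * vol H (sweepSet ord (j + 1))
          = k := by
        rw [hvol, hθ]
        field_simp
        ring
      rw [hkeq] at hcc
      have h1 := mul_le_mul_of_nonneg_left (hsweep j hjn.le) (sub_nonneg.2 hθ1)
      have h2 := mul_le_mul_of_nonneg_left (hsweep (j + 1) hj) hθ0
      have h3 : p v / deg H v * (k - vol H (sweepSet ord j)) = θ * p v := by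
        rw [hθ]; ring
      rw [hmass] at h2
      linarith
  refine key _ le_rfl ?_
  rw [sweepSet_card, vol]
  push_cast
  exact Finset.sum_le_sum fun u _ => mul_le_of_le_one_left (hD u).le (hw u).2

/-- The bound on the Lovász–Simonovits curve after `t` steps of a walk with teleport probability
`α`, per-degree residual `ε` and contraction factor `c` on a graph of volume `M`. -/
noncomputable def lsBound (M α ε c : ℝ) (t : ℕ) (k : ℝ) : ℝ :=
  k / M + (α * t + α * ε * k * t + √(min k (M - k)) * c ^ t)

lemma concaveOn_lsBound (M α ε : ℝ) {c : ℝ} (hc : 0 ≤ c) (t : ℕ) :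
    ConcaveOn ℝ (Set.Icc 0 M) (lsBound M α ε c t) := by
  have h1 : ConcaveOn ℝ (Set.Icc 0 M) (fun k : ℝ => min k (M - k)) :=
    (concaveOn_id (convex_Icc 0 M)).inf
      ((concaveOn_const M (convex_Icc 0 M)).sub (convexOn_id (convex_Icc 0 M)))
  refine ⟨convex_Icc 0 M, fun x hx y hy a b ha hb hab => ?_⟩
  have h2 := h1.2 hx hy ha hb hab
  have hx0 : 0 ≤ min x (M - x) := le_min hx.1 (sub_nonneg.2 hx.2)
  have hy0 : 0 ≤ min y (M - y) := le_min hy.1 (sub_nonneg.2 hy.2)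
  have h3 := Real.strictConcaveOn_sqrt.concaveOn.2 (Set.mem_Ici.2 hx0) (Set.mem_Ici.2 hy0)
    ha hb hab
  simp only [smul_eq_mul] at h2 h3 ⊢
  have h4 := mul_le_mul_of_nonneg_right (h3.trans (Real.sqrt_le_sqrt h2)) (pow_nonneg hc t)
  have hb' : b = 1 - a := by linarith
  subst hb'
  unfold lsBound
  calc _ = (a * x + (1 - a) * y) / M + (α * t + α * ε * (a * x + (1 - a) * y) * t
        + (a * √(min x (M - x)) + (1 - a) * √(min y (M - y))) * c ^ t) := by ring
    _ ≤ _ := by linarith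

/-- One step of the Lovász–Simonovits argument on a set of conductance at least `φ`. -/
lemma sum_le_lsBound_succ (H : SimpleGraph W) (hdeg : ∀ v, 0 < deg H v)
    {α ε φ : ℝ} (hα0 : 0 < α) (hα1 : α ≤ 1) (hφ0 : 0 ≤ φ) (hφ1 : φ ≤ 1) (hε : 0 ≤ ε)
    {s r p : W → ℝ} (hs : ∀ x, 0 ≤ s x) (hs1 : ∑ x, s x = 1)
    (hr : ∀ x, r x ≤ ε * deg H x)
    (hp : ∀ x, p x ≤ α * s x + α * r x + (1 - α) * lazyWalk H p x)
    {t : ℕ}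
    (ih : ∀ w : W → ℝ, (∀ u, 0 ≤ w u ∧ w u ≤ 1) → ∑ u, w u * p u
      ≤ lsBound (vol H univ) α ε (1 - φ ^ 2 / 8) t (∑ u, w u * (deg H u : ℝ)))
    {S : Finset W} (hcut : φ * vol H S ≤ cutEdges H S Sᶜ) :
    ∑ x ∈ S, p x ≤ vol H S / vol H univ + (α * (t + 1 : ℕ) + α * ε * vol H S * (t + 1 : ℕ)
      + √(vol H S) * (1 - φ ^ 2 / 8) ^ (t + 1)) := by
  have hD : ∀ v, (0 : ℝ) < deg H v := fun v => by exact_mod_cast hdeg v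
  have hc : 0 ≤ 1 - φ ^ 2 / 8 := by nlinarith
  set c := 1 - φ ^ 2 / 8 with hcdef
  set x := (vol H S : ℝ) with hx
  set M := (vol H univ : ℝ) with hM
  set d := (cutEdges H S Sᶜ : ℝ) with hd
  have hx0 : 0 ≤ x := Nat.cast_nonneg _
  have hM0 : 0 ≤ M := Nat.cast_nonneg _
  have hxsum : x = ∑ u ∈ S, (deg H u : ℝ) := by rw [hx, vol]; push_cast; rfl
  -- the fraction of arcs leaving `u` that end in `S`
  let e : W → ℝ := fun u => (∑ v ∈ S, adjInd H u v) / (deg H u : ℝ)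
  have he0 : ∀ u, 0 ≤ e u := fun u =>
    div_nonneg (Finset.sum_nonneg fun v _ => adjInd_nonneg H u v) (hD u).le
  have he1 : ∀ u, e u ≤ 1 := fun u => by
    rw [div_le_one (hD u), deg_eq_sum_adjInd]
    exact Finset.sum_le_sum_of_subset_of_nonneg (Finset.subset_univ S)
      fun v _ _ => adjInd_nonneg H u v
  have heD : ∀ u, e u * deg H u = ∑ v ∈ S, adjInd H u v := fun u =>
    div_mul_cancel₀ _ (hD u).ne'
  have hinner : ∑ u ∈ S, ∑ v ∈ S, adjInd H u v = x - d := by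
    rw [hxsum, hd, cutEdges_eq_sum_adjInd, ← Finset.sum_sub_distrib]
    refine Finset.sum_congr rfl fun u _ => ?_
    rw [deg_eq_sum_adjInd, ← Finset.sum_add_sum_compl S]
    ring
  have houter : ∑ u ∈ Sᶜ, ∑ v ∈ S, adjInd H u v = d := by
    rw [hd, cutEdges_eq_sum_adjInd, Finset.sum_comm]
    exact Finset.sum_congr rfl fun u _ => Finset.sum_congr rfl fun v _ => adjInd_comm H v u
  have hdx : d ≤ x := by
    have : 0 ≤ ∑ u ∈ S, ∑ v ∈ S, adjInd H u v :=
      Finset.sum_nonneg fun u _ => Finset.sum_nonneg fun v _ => adjInd_nonneg H u v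
    linarith
  let w₁ : W → ℝ := fun u => if u ∈ S then 1 else e u
  let w₂ : W → ℝ := fun u => if u ∈ S then e u else 0
  have hsplit : ∀ f : W → ℝ, ∑ u, f u = ∑ u ∈ S, f u + ∑ u ∈ Sᶜ, f u := fun f =>
    (Finset.sum_add_sum_compl S f).symm
  have hw₁ : ∀ f : W → ℝ, ∑ u, w₁ u * f u = ∑ u ∈ S, f u + ∑ u ∈ Sᶜ, e u * f u := fun f => by
    rw [hsplit]
    congr 1
    · exact Finset.sum_congr rfl fun u hu => by simp [w₁, hu]
    · exact Finset.sum_congr rfl fun u hu => by simp [w₁, Finset.mem_compl.1 hu]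
  have hw₂ : ∀ f : W → ℝ, ∑ u, w₂ u * f u = ∑ u ∈ S, e u * f u := fun f => by
    rw [hsplit, Finset.sum_eq_zero (s := Sᶜ), add_zero]
    · exact Finset.sum_congr rfl fun u hu => by simp [w₂, hu]
    · exact fun u hu => by simp [w₂, Finset.mem_compl.1 hu]
  have ih₁ := ih w₁ fun u => by
    by_cases hu : u ∈ S <;> simp [w₁, hu, he0, he1]
  have ih₂ := ih w₂ fun u => by
    by_cases hu : u ∈ S <;> simp [w₂, hu, he0, he1]
  have hk₁ : ∑ u, w₁ u * (deg H u : ℝ) = x + d := by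
    rw [hw₁]; simp only [heD]; rw [houter, hxsum]
  have hk₂ : ∑ u, w₂ u * (deg H u : ℝ) = x - d := by
    rw [hw₂]; simp only [heD]; rw [hinner]
  rw [hk₁] at ih₁
  rw [hk₂] at ih₂
  have hwalk : ∑ u ∈ S, lazyWalk H p u = (1/2) * (∑ u, w₁ u * p u + ∑ u, w₂ u * p u) := by
    rw [sum_lazyWalk, hw₁, hw₂, hsplit (fun y => _ / (deg H y : ℝ) * p y)]
    ring
  have hsqrt₁ : √(min (x + d) (M - (x + d))) ≤ √(x + d) := Real.sqrt_le_sqrt (min_le_left _ _)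
  have hsqrt₂ : √(min (x - d) (M - (x - d))) ≤ √(x - d) := Real.sqrt_le_sqrt (min_le_left _ _)
  have hsqrt : √(min (x + d) (M - (x + d))) + √(min (x - d) (M - (x - d))) ≤ 2 * (√x * c) :=
    (add_le_add hsqrt₁ hsqrt₂).trans (sqrt_add_sqrt_le hφ0 hφ1 hx0 hcut hdx)
  have hB := mul_le_mul_of_nonneg_right hsqrt (pow_nonneg hc t)
  have hwalk_le : ∑ u ∈ S, lazyWalk H p u
      ≤ x / M + (α * t + α * ε * x * t + √x * c ^ (t + 1)) := by
    rw [hwalk]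
    unfold lsBound at ih₁ ih₂
    have : (x + d) / M + (x - d) / M = 2 * (x / M) := by ring
    rw [pow_succ]
    nlinarith
  have hnn : 0 ≤ x / M + (α * t + α * ε * x * t + √x * c ^ (t + 1)) := by positivity
  have hsS : ∑ u ∈ S, s u ≤ 1 := by
    rw [← hs1]
    exact Finset.sum_le_sum_of_subset_of_nonneg (Finset.subset_univ S) fun u _ _ => hs u
  have hrS : ∑ u ∈ S, r u ≤ ε * x := by
    rw [hxsum, Finset.mul_sum]
    exact Finset.sum_le_sum fun u _ => hr u
  have hpS : ∑ u ∈ S, p u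
      ≤ α * ∑ u ∈ S, s u + α * ∑ u ∈ S, r u + (1 - α) * ∑ u ∈ S, lazyWalk H p u := by
    simp only [Finset.mul_sum, ← Finset.sum_add_distrib]
    exact Finset.sum_le_sum fun u _ => hp u
  have h1 := mul_le_mul_of_nonneg_left hsS hα0.le
  have h2 := mul_le_mul_of_nonneg_left hrS hα0.le
  have h3 := mul_le_mul_of_nonneg_left hwalk_le (sub_nonneg.2 hα1)
  have h4 := mul_nonneg hα0.le hnn
  push_cast
  nlinarith

lemma sum_mul_le_sqrt (H : SimpleGraph W) (hdeg : ∀ v, 0 < deg H v) [Nonempty W]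
    {p : W → ℝ} (hp0 : ∀ x, 0 ≤ p x) (hp1 : ∑ x, p x ≤ 1)
    {w : W → ℝ} (hw : ∀ u, 0 ≤ w u ∧ w u ≤ 1) {k : ℝ}
    (hk : ∑ u, w u * (deg H u : ℝ) = k) :
    ∑ u, w u * p u ≤ k / vol H univ + √(min k (vol H univ - k)) := by
  have hD : ∀ v, (1 : ℝ) ≤ deg H v := fun v => by exact_mod_cast hdeg v
  have hM : (1 : ℝ) ≤ vol H univ := by
    obtain ⟨v⟩ := ‹Nonempty W›
    have : deg H v ≤ vol H univ :=
      Finset.single_le_sum (f := deg H) (fun _ _ => Nat.zero_le _) (Finset.mem_univ v)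
    exact_mod_cast (hdeg v).trans_le this
  set M := (vol H univ : ℝ)
  have hk0 : 0 ≤ k := hk ▸ Finset.sum_nonneg fun u _ =>
    mul_nonneg (hw u).1 (Nat.cast_nonneg _)
  have hkM : 0 ≤ k / M := by positivity
  have hA : ∑ u, w u * p u ≤ 1 :=
    (Finset.sum_le_sum fun u _ => mul_le_of_le_one_left (hp0 u) (hw u).2).trans hp1
  have hB : ∑ u, w u * p u ≤ k := by
    rw [← hk]
    refine Finset.sum_le_sum fun u _ => mul_le_mul_of_nonneg_left ?_ (hw u).1
    exact ((Finset.single_le_sum (fun v _ => hp0 v) (Finset.mem_univ u)).trans hp1).trans (hD u)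
  rcases le_total k (M - k) with h | h
  · rw [min_eq_left h]
    have : ∑ u, w u * p u ≤ √k := by
      rcases le_total 1 k with h1 | h1
      · exact hA.trans (Real.one_le_sqrt.2 h1)
      · exact hB.trans (Real.le_sqrt_of_sq_le (by nlinarith))
    linarith
  · rw [min_eq_right h]
    have hkM' : k ≤ M := by
      rw [← hk]
      simp only [M, vol, Nat.cast_sum]
      exact Finset.sum_le_sum fun u _ =>
        mul_le_of_le_one_left (Nat.cast_nonneg _) (hw u).2
    have h1 : 1 - k / M = (M - k) / M := by field_simp
    have h2 : (M - k) / M ≤ √(M - k) := by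
      apply Real.le_sqrt_of_sq_le
      rw [div_pow, div_le_iff₀ (by positivity)]
      nlinarith [mul_nonneg (sub_nonneg.2 hkM') (show 0 ≤ M ^ 2 - (M - k) by nlinarith)]
    linarith

lemma mem_sweepSet_of_ne_zero (H : SimpleGraph W) (hdeg : ∀ v, 0 < deg H v) {p : W → ℝ}
    (hp0 : ∀ x, 0 ≤ p x) (ord : Fin (Fintype.card W) ≃ W)
    (hord : ∀ i j, i ≤ j → p (ord j) / (deg H (ord j) : ℝ) ≤ p (ord i) / (deg H (ord i) : ℝ))
    {j : ℕ} (hj : suppCard p ≤ j) {x : W} (hx : p x ≠ 0) : x ∈ sweepSet ord j := by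
  have hD : ∀ v, (0 : ℝ) < deg H v := fun v => by exact_mod_cast hdeg v
  obtain ⟨i, rfl⟩ := ord.surjective x
  by_contra hmem
  have hij : j ≤ i := by simpa [sweepSet] using hmem
  have hsub : ord '' Set.Iic i ⊆ {x | p x ≠ 0} := by
    rintro _ ⟨l, hl, rfl⟩
    have h1 : 0 < p (ord i) / (deg H (ord i) : ℝ) :=
      div_pos ((hp0 _).lt_of_ne' hx) (hD _)
    exact ((div_pos_iff_of_pos_right (hD _)).1 (h1.trans_le (hord l i hl))).ne'
  have h2 := Set.ncard_le_ncard hsub (Set.toFinite _)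
  rw [Set.ncard_image_of_injective _ ord.injective, ← Finset.coe_Iic, Set.ncard_coe_finset,
    Fin.card_Iic] at h2
  unfold suppCard at hj
  omega

lemma ne_zero_of_mem_sweepSet (H : SimpleGraph W) (hdeg : ∀ v, 0 < deg H v) {p : W → ℝ}
    (hp0 : ∀ x, 0 ≤ p x) (ord : Fin (Fintype.card W) ≃ W)
    (hord : ∀ i j, i ≤ j → p (ord j) / (deg H (ord j) : ℝ) ≤ p (ord i) / (deg H (ord i) : ℝ))
    {j : ℕ} (hj : j ≤ suppCard p) {x : W} (hx : x ∈ sweepSet ord j) : p x ≠ 0 := by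
  have hD : ∀ v, (0 : ℝ) < deg H v := fun v => by exact_mod_cast hdeg v
  obtain ⟨i, rfl⟩ := ord.surjective x
  intro hpi
  have hij : (i : ℕ) < j := by simpa [sweepSet] using hx
  have hsub : {x | p x ≠ 0} ⊆ ord '' Set.Iio i := by
    intro x hx
    obtain ⟨l, rfl⟩ := ord.surjective x
    refine ⟨l, ?_, rfl⟩
    by_contra hl
    have h1 := hord i l (not_lt.1 hl)
    rw [hpi, zero_div, div_le_iff₀ (hD _), zero_mul] at h1
    exact hx (le_antisymm h1 (hp0 _))
  have h2 := Set.ncard_le_ncard hsub (Set.toFinite _)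
  rw [Set.ncard_image_of_injective _ ord.injective, ← Finset.coe_Iio, Set.ncard_coe_finset,
    Fin.card_Iio] at h2
  unfold suppCard at hj
  omega

/-- A Lovász–Simonovits bound for subsolutions of the Pagerank equation whose sweep sets have
at most half of the total volume. -/
theorem sum_mul_le_lsBound (H : SimpleGraph W) (hdeg : ∀ v, 0 < deg H v) [Nonempty W]
    {α ε φ : ℝ} (hα0 : 0 < α) (hα1 : α ≤ 1) (hφ0 : 0 ≤ φ) (hφ1 : φ ≤ 1) (hε : 0 ≤ ε)
    {s r p : W → ℝ} (hs : ∀ x, 0 ≤ s x) (hs1 : ∑ x, s x = 1)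
    (hr : ∀ x, r x ≤ ε * deg H x) (hp0 : ∀ x, 0 ≤ p x) (hp1 : ∑ x, p x ≤ 1)
    (hp : ∀ x, p x ≤ α * s x + α * r x + (1 - α) * lazyWalk H p x)
    (ord : Fin (Fintype.card W) ≃ W)
    (hord : ∀ i j, i ≤ j → p (ord j) / (deg H (ord j) : ℝ) ≤ p (ord i) / (deg H (ord i) : ℝ))
    (hhalf : ∀ j ≤ suppCard p, vol H (sweepSet ord j) ≤ vol H (sweepSet ord j)ᶜ)
    (hcond : ∀ j, 1 ≤ j → j ≤ suppCard p → φ ≤ conductance H (sweepSet ord j))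
    (t : ℕ) : ∀ w : W → ℝ, (∀ u, 0 ≤ w u ∧ w u ≤ 1) → ∑ u, w u * p u
      ≤ lsBound (vol H univ) α ε (1 - φ ^ 2 / 8) t (∑ u, w u * (deg H u : ℝ)) := by
  have hc : 0 ≤ 1 - φ ^ 2 / 8 := by nlinarith
  have hM : (0 : ℝ) < vol H univ := by
    exact_mod_cast Finset.sum_pos (fun v _ => hdeg v) Finset.univ_nonempty
  have hsplit : ∀ S : Finset W, (vol H S : ℝ) + vol H Sᶜ = vol H univ := fun S => by
    exact_mod_cast Finset.sum_add_sum_compl S (deg H)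
  induction t with
  | zero =>
    intro w hw
    simpa [lsBound] using sum_mul_le_sqrt H hdeg hp0 hp1 hw rfl
  | succ t ih =>
    intro w hw
    have hconc := concaveOn_lsBound (vol H univ : ℝ) α ε hc (t + 1)
    refine sum_mul_le_of_sweepSet H hdeg p ord hord hconc ?_ hw
    have hsmall : ∀ j ≤ suppCard p, ∑ x ∈ sweepSet ord j, p x
        ≤ lsBound (vol H univ) α ε (1 - φ ^ 2 / 8) (t + 1) (vol H (sweepSet ord j)) := by
      intro j hj
      have hv : (vol H (sweepSet ord j) : ℝ) ≤ vol H (sweepSet ord j)ᶜ := by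
        exact_mod_cast hhalf j hj
      rw [lsBound, min_eq_left (by linarith [hsplit (sweepSet ord j)])]
      refine sum_le_lsBound_succ H hdeg hα0 hα1 hφ0 hφ1 hε hs hs1 hr hp ih ?_
      rcases Nat.eq_zero_or_pos j with rfl | hj1
      · simp [sweepSet_zero, vol]
      have h := hcond j hj1 hj
      rw [conductance, min_eq_left hv] at h
      rcases (Nat.cast_nonneg (vol H (sweepSet ord j)) : (0 : ℝ) ≤ _).eq_or_lt with h0 | h0
      · rw [← h0, mul_zero]
        exact Nat.cast_nonneg _
      · exact (le_div_iff₀ h0).1 h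
    intro j _
    rcases le_total j (suppCard p) with hj | hj
    · exact hsmall j hj
    have hmass : ∀ i, suppCard p ≤ i → ∑ x ∈ sweepSet ord i, p x = ∑ x, p x := fun i hi =>
      Finset.sum_subset (Finset.subset_univ _) fun x _ hx => by
        by_contra hne
        exact hx (mem_sweepSet_of_ne_zero H hdeg hp0 ord hord hi hne)
    have hm := hsmall _ le_rfl
    rw [hmass _ le_rfl] at hm
    rw [hmass j hj]
    have hend : ∑ x, p x ≤ lsBound (vol H univ) α ε (1 - φ ^ 2 / 8) (t + 1) (vol H univ) := by
      refine hp1.trans ?_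
      rw [lsBound, div_self hM.ne']
      have : 0 ≤ α * (t + 1 : ℕ) + α * ε * vol H univ * (t + 1 : ℕ)
        + √(min (vol H univ : ℝ) (vol H univ - vol H univ)) * (1 - φ ^ 2 / 8) ^ (t + 1) := by
        positivity
      linarith
    refine (le_min hm hend).trans (hconc.min_le_of_mem_Icc ?_ ?_ ?_)
    · exact ⟨Nat.cast_nonneg _, by
        exact_mod_cast Finset.sum_le_sum_of_subset (Finset.subset_univ _)⟩
    · exact ⟨hM.le, le_rfl⟩
    · constructor
      · have : sweepSet ord (suppCard p) ⊆ sweepSet ord j := fun x hx => by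
          simp only [sweepSet, Finset.mem_filter, Finset.mem_univ, true_and] at hx ⊢
          omega
        exact_mod_cast Finset.sum_le_sum_of_subset this
      · exact_mod_cast Finset.sum_le_sum_of_subset (Finset.subset_univ _)

end LovaszSimonovits

section DoubleCover

lemma doubleCover_adj_inl_inr (G : SimpleGraph V) (u v : V) :
    (doubleCover G).Adj (Sum.inl u) (Sum.inr v) ↔ G.Adj u v := by
  simp [doubleCover]

lemma doubleCover_adj_inr_inl (G : SimpleGraph V) (u v : V) :
    (doubleCover G).Adj (Sum.inr u) (Sum.inl v) ↔ G.Adj u v := by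
  simp [doubleCover, G.adj_comm]

lemma doubleCover_adj_inl_inl (G : SimpleGraph V) (u v : V) :
    ¬ (doubleCover G).Adj (Sum.inl u) (Sum.inl v) := by
  simp [doubleCover]

lemma doubleCover_adj_inr_inr (G : SimpleGraph V) (u v : V) :
    ¬ (doubleCover G).Adj (Sum.inr u) (Sum.inr v) := by
  simp [doubleCover]

lemma deg_doubleCover_inl (G : SimpleGraph V) (u : V) :
    deg (doubleCover G) (Sum.inl u) = deg G u := by
  have : {x | (doubleCover G).Adj (Sum.inl u) x} = Sum.inr '' {v | G.Adj u v} := by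
    ext (v | v) <;> simp [doubleCover_adj_inl_inl, doubleCover_adj_inl_inr]
  rw [deg, this, Set.ncard_image_of_injective _ Sum.inr_injective, deg]

lemma deg_doubleCover_inr (G : SimpleGraph V) (u : V) :
    deg (doubleCover G) (Sum.inr u) = deg G u := by
  have : {x | (doubleCover G).Adj (Sum.inr u) x} = Sum.inl '' {v | G.Adj u v} := by
    ext (v | v) <;> simp [doubleCover_adj_inr_inr, doubleCover_adj_inr_inl]
  rw [deg, this, Set.ncard_image_of_injective _ Sum.inl_injective, deg]

lemma deg_doubleCover_swap (G : SimpleGraph V) (x : V ⊕ V) :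
    deg (doubleCover G) x.swap = deg (doubleCover G) x := by
  cases x <;> simp [deg_doubleCover_inl, deg_doubleCover_inr]

lemma doubleCover_adj_swap (G : SimpleGraph V) (x y : V ⊕ V) :
    (doubleCover G).Adj x.swap y.swap ↔ (doubleCover G).Adj x y := by
  rcases x with u | u <;> rcases y with v | v <;>
    simp [doubleCover_adj_inl_inl, doubleCover_adj_inr_inr, doubleCover_adj_inl_inr,
      doubleCover_adj_inr_inl]

lemma adjInd_swap (G : SimpleGraph V) (x y : V ⊕ V) :
    adjInd (doubleCover G) x.swap y.swap = adjInd (doubleCover G) x y := by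
  classical
  unfold adjInd
  exact if_congr (doubleCover_adj_swap G x y) rfl rfl

lemma simplify_apply (p : V ⊕ V → ℝ) (x : V ⊕ V) :
    simplify p x = max 0 (p x - p x.swap) := by
  cases x <;> rfl

lemma simplify_nonneg (p : V ⊕ V → ℝ) (x : V ⊕ V) : 0 ≤ simplify p x := by
  rw [simplify_apply]; exact le_max_left _ _

lemma simplify_le (p : V ⊕ V → ℝ) (hp : ∀ x, 0 ≤ p x) (x : V ⊕ V) : simplify p x ≤ p x := by
  rw [simplify_apply]
  exact max_le (hp x) (by linarith [hp x.swap])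

lemma lazyWalk_nonneg (H : SimpleGraph V) {p : V → ℝ} (hp : ∀ x, 0 ≤ p x) (x : V) :
    0 ≤ lazyWalk H p x := by
  rw [lazyWalk_eq]
  have : 0 ≤ ∑ y, adjInd H y x * (p y / (deg H y : ℝ)) := Finset.sum_nonneg fun y _ =>
    mul_nonneg (adjInd_nonneg H y x) (div_nonneg (hp y) (Nat.cast_nonneg _))
  have := hp x
  positivity

lemma lazyWalk_sub_swap_le (G : SimpleGraph V) (p : V ⊕ V → ℝ) (x : V ⊕ V) :
    lazyWalk (doubleCover G) p x - lazyWalk (doubleCover G) p x.swap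
      ≤ lazyWalk (doubleCover G) (simplify p) x := by
  have hle : ∀ y, p y - p y.swap ≤ simplify p y := fun y => by
    rw [simplify_apply]; exact le_max_right _ _
  have hswap : ∑ y, adjInd (doubleCover G) y x.swap * (p y / (deg (doubleCover G) y : ℝ))
      = ∑ y, adjInd (doubleCover G) y x * (p y.swap / (deg (doubleCover G) y : ℝ)) := by
    rw [← Equiv.sum_comp (Equiv.sumComm V V)]
    refine Finset.sum_congr rfl fun y _ => ?_
    simp only [Equiv.sumComm_apply, deg_doubleCover_swap, adjInd_swap]
  have hsum : ∑ y, adjInd (doubleCover G) y x * (p y / (deg (doubleCover G) y : ℝ))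
      - ∑ y, adjInd (doubleCover G) y x * (p y.swap / (deg (doubleCover G) y : ℝ))
      ≤ ∑ y, adjInd (doubleCover G) y x * (simplify p y / (deg (doubleCover G) y : ℝ)) := by
    rw [← Finset.sum_sub_distrib]
    refine Finset.sum_le_sum fun y _ => ?_
    rw [← mul_sub, ← sub_div]
    exact mul_le_mul_of_nonneg_left
      (div_le_div_of_nonneg_right (hle y) (Nat.cast_nonneg _)) (adjInd_nonneg _ _ _)
  simp only [lazyWalk_eq]
  rw [hswap]
  linarith [hle x]

lemma IsApr.eq {H : SimpleGraph V} {α : ℝ} {s r p : V → ℝ} (h : IsApr H α s r p) (x : V) :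
    p x = α * s x - α * r x + (1 - α) * lazyWalk H p x := by
  obtain ⟨qs, qr, hqs, hqr, hp⟩ := h
  have hp' : p = fun y => qs y - qr y := funext fun y => by linarith [hp y]
  have hlin : lazyWalk H p x = lazyWalk H qs x - lazyWalk H qr x := by
    simp only [lazyWalk_eq, hp', sub_div, mul_sub, Finset.sum_sub_distrib]
    ring
  have h1 := hqs x
  have h2 := hqr x
  rw [hlin]
  linarith [hp x]

lemma simplify_apr_le (G : SimpleGraph V) {α : ℝ} (hα0 : 0 < α) (hα1 : α ≤ 1)
    {s r p : V ⊕ V → ℝ} (hs : ∀ x, 0 ≤ s x) (hr : ∀ x, 0 ≤ r x)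
    (h : IsApr (doubleCover G) α s r p) (x : V ⊕ V) :
    simplify p x ≤ α * s x + α * r x.swap
      + (1 - α) * lazyWalk (doubleCover G) (simplify p) x := by
  have h1 := mul_nonneg hα0.le (hs x)
  have h2 := mul_nonneg hα0.le (hr x.swap)
  have h3 := mul_nonneg (sub_nonneg.2 hα1)
    (lazyWalk_nonneg (doubleCover G) (simplify_nonneg p) x)
  have h4 := mul_nonneg hα0.le (hs x.swap)
  have h5 := mul_nonneg hα0.le (hr x)
  have h6 := mul_le_mul_of_nonneg_left (lazyWalk_sub_swap_le G p x) (sub_nonneg.2 hα1)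
  rw [simplify_apply]
  refine max_le (by linarith) ?_
  linarith [h.eq x, h.eq x.swap]

lemma vol_le_vol_compl_of_simplify_ne_zero (G : SimpleGraph V) (p : V ⊕ V → ℝ)
    {S : Finset (V ⊕ V)} (hS : ∀ x ∈ S, simplify p x ≠ 0) :
    vol (doubleCover G) S ≤ vol (doubleCover G) Sᶜ := by
  have h1 : vol (doubleCover G) S
      = vol (doubleCover G) (S.map (Equiv.sumComm V V).toEmbedding) := by
    simp [vol, deg_doubleCover_swap]
  rw [h1]
  refine Finset.sum_le_sum_of_subset fun y hy => ?_
  obtain ⟨x, hx, rfl⟩ := Finset.mem_map.1 hy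
  rw [Finset.mem_compl]
  intro hmem
  have h2 := hS x hx
  have h3 := hS _ hmem
  simp only [Equiv.coe_toEmbedding, Equiv.sumComm_apply, simplify_apply, Sum.swap_swap,
    ne_eq, max_eq_left_iff, not_le] at h2 h3
  linarith

end DoubleCover

/-- Let `G` have positive degrees everywhere with double cover `H`.
Let `α ∈ (0,1]`, `s` nonnegative with `‖s‖₁ = 1`, `r` nonnegative with
`apr_H(α,s,r)` entrywise nonnegative, `p = σ∘apr_H(α,s,r)`, and
`max_u r(u)/deg(u) ≤ ε`. Let `φ ∈ [0,1]`. If `Φ_H(S_j^p) ≥ φ` for all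
`j ∈ [1, |supp(p)|]`, then for all `k ∈ [0, vol(V_H)]` and integers `t ≥ 0`:
`p[k] - k/vol(V_H) ≤ αt + αεkt + √(min(k, vol(V_H) - k)) (1 - φ²/8)^t`. -/
theorem statement13 (G : SimpleGraph V) (hdeg : ∀ v, 0 < deg G v)
    (α ε φ : ℝ) (hα0 : 0 < α) (hα1 : α ≤ 1) (hφ0 : 0 ≤ φ) (hφ1 : φ ≤ 1)
    (s r p' : V ⊕ V → ℝ) (hs : ∀ x, 0 ≤ s x) (hs1 : ∑ x, s x = 1)
    (hr : ∀ x, 0 ≤ r x)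
    (happr : IsApr (doubleCover G) α s r p') (hp' : ∀ x, 0 ≤ p' x)
    (hres : ∀ u : V ⊕ V, r u / (deg (doubleCover G) u : ℝ) ≤ ε)
    (ord : Fin (Fintype.card (V ⊕ V)) ≃ (V ⊕ V))
    (hord : ∀ i j, i ≤ j →
      simplify p' (ord j) / (deg (doubleCover G) (ord j) : ℝ)
        ≤ simplify p' (ord i) / (deg (doubleCover G) (ord i) : ℝ))
    (hcond : ∀ j, 1 ≤ j → j ≤ suppCard (simplify p') →
      φ ≤ conductance (doubleCover G) (sweepSet ord j))
    (k : ℝ) (hk0 : 0 ≤ k) (hk1 : k ≤ (vol (doubleCover G) Finset.univ : ℝ))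
    (t : ℕ) :
    lsCurve (doubleCover G) (simplify p') k
        - k / (vol (doubleCover G) Finset.univ : ℝ)
      ≤ α * t + α * ε * k * t
        + Real.sqrt (min k ((vol (doubleCover G) Finset.univ : ℝ) - k))
          * (1 - φ ^ 2 / 8) ^ t := by
  have hdegH : ∀ x, 0 < deg (doubleCover G) x := by
    rintro (v | v)
    · rw [deg_doubleCover_inl]; exact hdeg v
    · rw [deg_doubleCover_inr]; exact hdeg v
  have hne : Nonempty (V ⊕ V) := by
    by_contra h
    rw [not_nonempty_iff] at h
    simp at hs1
  have hε : 0 ≤ ε := by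
    obtain ⟨x⟩ := hne
    exact (div_nonneg (hr x) (Nat.cast_nonneg _)).trans (hres x)
  have hp1 : ∑ x, simplify p' x ≤ 1 := by
    refine (Finset.sum_le_sum fun x _ => simplify_le p' hp' x).trans ?_
    obtain ⟨qs, qr, hqs, hqr, hp⟩ := happr
    have h1 := hqs.sum_eq hdegH hα0
    have h2 := hqr.sum_eq hdegH hα0
    have h3 : ∑ x, p' x + ∑ x, qr x = ∑ x, qs x := by
      rw [← Finset.sum_add_distrib]
      exact Finset.sum_congr rfl fun x _ => hp x
    have h4 : 0 ≤ ∑ x, r x := Finset.sum_nonneg fun x _ => hr x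
    linarith
  have hr' : ∀ x : V ⊕ V, r x.swap ≤ ε * deg (doubleCover G) x := fun x => by
    have h := hres x.swap
    rwa [deg_doubleCover_swap, div_le_iff₀ (by exact_mod_cast hdegH x)] at h
  have key := sum_mul_le_lsBound (doubleCover G) hdegH hα0 hα1 hφ0 hφ1 hε hs hs1
    (r := fun x => r x.swap) hr' (simplify_nonneg p') hp1
    (simplify_apr_le G hα0 hα1 hs hr happr) ord hord
    (fun j hj => vol_le_vol_compl_of_simplify_ne_zero G p' fun x hx =>
      ne_zero_of_mem_sweepSet _ hdegH (simplify_nonneg p') ord hord hj hx) hcond t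
  have hc : 0 ≤ 1 - φ ^ 2 / 8 := by nlinarith
  rw [sub_le_iff_le_add']
  refine Real.sSup_le ?_ (by positivity)
  rintro y ⟨w, hw, hwk, rfl⟩
  have h := key w hw
  rwa [hwk, lsBound] at h

end Paper
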